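/- Lemma 2: The matrix I − ΞW is invertible if and only if Assumption 2 holds, i.e., if and only if every ISCC of G(W) contains at least one stubborn agent (some i in the ISCC with ξᵢ < 1). -/

import Mathlib

open Matrix Filter Finset

/-- `S` is an independent strongly connected component of the influence graph `G(W)`
(edge from `j` to `i` iff `W i j ≠ 0`): nonempty, in-closed and strongly connected. -/
def IsISCC {n : ℕ} (W : Matrix (Fin n) (Fin n) ℝ) (S : Set (Fin n)) : Prop :=
  S.Nonempty ∧ (∀ i ∈ S, ∀ j, W i j ≠ 0 → j ∈ S) ∧
    (∀ i ∈ S, ∀ j ∈ S, i ≠ j → ∃ m, 1 ≤ m ∧ 0 < (W ^ m) i j)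

/-- Index sets that are in-closed for `W` are in-closed for its powers. -/
lemma mem_of_pow_apply_ne_zero {n : ℕ} {W : Matrix (Fin n) (Fin n) ℝ} {S : Set (Fin n)}
    (hS : ∀ i ∈ S, ∀ j, W i j ≠ 0 → j ∈ S) (m : ℕ) {i j : Fin n} (hi : i ∈ S)
    (h : (W ^ m) i j ≠ 0) : j ∈ S := by
  induction m generalizing j with
  | zero =>
    by_cases hij : i = j
    · exact hij ▸ hi
    · simp [hij] at h
  | succ m ih =>
    rw [pow_succ, Matrix.mul_apply] at h
    obtain ⟨k, -, hk⟩ := Finset.exists_ne_zero_of_sum_ne_zero h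
    exact hS k (ih (left_ne_zero_of_mul hk)) j (right_ne_zero_of_mul hk)

/-- A nonempty in-closed set contains an independent strongly connected component. -/
lemma exists_isISCC_subset {n : ℕ} {W : Matrix (Fin n) (Fin n) ℝ}
    (hW0 : ∀ i j, 0 ≤ W i j) (hW1 : ∀ i, ∑ j, W i j = 1) {T : Set (Fin n)}
    (hne : T.Nonempty) (hT : ∀ i ∈ T, ∀ j, W i j ≠ 0 → j ∈ T) :
    ∃ S ⊆ T, IsISCC W S := by
  obtain ⟨S, hST, hS⟩ := exists_minimal_le_of_wellFoundedLT
    (fun S : Set (Fin n) => S.Nonempty ∧ ∀ i ∈ S, ∀ j, W i j ≠ 0 → j ∈ S) T ⟨hne, hT⟩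
  obtain ⟨hSne, hSc⟩ := hS.prop
  refine ⟨S, hST, hSne, hSc, fun i hi j hj _ => ?_⟩
  have hsub : {k | ∃ m, 1 ≤ m ∧ 0 < (W ^ m) i k} ⊆ S := by
    rintro k ⟨m, -, hm⟩
    exact mem_of_pow_apply_ne_zero hSc m hi hm.ne'
  refine hS.le_of_le ⟨?_, ?_⟩ hsub hj
  · have h : ∑ k, W i k ≠ 0 := by rw [hW1]; exact one_ne_zero
    obtain ⟨k, -, hk⟩ := Finset.exists_ne_zero_of_sum_ne_zero h
    exact ⟨k, 1, le_rfl, by rw [pow_one]; exact (hW0 i k).lt_of_ne' hk⟩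
  · rintro k ⟨m, -, hm⟩ l hl
    refine ⟨m + 1, m.succ_pos, ?_⟩
    rw [pow_succ, Matrix.mul_apply]
    exact Finset.sum_pos' (fun p _ => mul_nonneg (pow_apply_nonneg hW0 m i p) (hW0 p l))
      ⟨k, Finset.mem_univ k, mul_pos hm ((hW0 k l).lt_of_ne' hl)⟩

lemma one_sub_diagonal_mul_mulVec_apply {n : ℕ} (W : Matrix (Fin n) (Fin n) ℝ)
    (ξ x : Fin n → ℝ) (i : Fin n) :
    ((1 - Matrix.diagonal ξ * W) *ᵥ x) i = x i - ξ i * ∑ j, W i j * x j := by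
  rw [Matrix.sub_mulVec, Matrix.one_mulVec, ← Matrix.mulVec_mulVec, Pi.sub_apply,
    Matrix.mulVec_diagonal]
  rfl

/-- `I - ΞW` is singular as soon as some nonempty in-closed set has no stubborn agent. -/
lemma exists_lt_one_of_isUnit {n : ℕ} {W : Matrix (Fin n) (Fin n) ℝ} {ξ : Fin n → ℝ}
    (hW0 : ∀ i j, 0 ≤ W i j) (hW1 : ∀ i, ∑ j, W i j = 1) (hξ : ∀ i, ξ i ≤ 1)
    (hU : IsUnit (1 - Matrix.diagonal ξ * W)) {S : Set (Fin n)} (hne : S.Nonempty)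
    (hS : ∀ i ∈ S, ∀ j, W i j ≠ 0 → j ∈ S) : ∃ i ∈ S, ξ i < 1 := by
  by_contra! h
  obtain ⟨x, hx⟩ := Matrix.mulVec_surjective_iff_isUnit.2 hU (fun _ => 1)
  obtain ⟨i, hi, hmin⟩ := S.toFinite.exists_minimalFor x S hne
  have hle : ∀ j ∈ S, x i ≤ x j := fun j hj => (le_total (x i) (x j)).elim id (hmin hj)
  have hxi := congrFun hx i
  rw [one_sub_diagonal_mul_mulVec_apply, (hξ i).antisymm (h i hi), one_mul] at hxi
  have hsum : ∑ j, W i j * x i ≤ ∑ j, W i j * x j := by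
    refine Finset.sum_le_sum fun j _ => ?_
    by_cases hj : W i j = 0
    · simp [hj]
    · exact mul_le_mul_of_nonneg_left (hle j (hS i hi j hj)) (hW0 i j)
  rw [← Finset.sum_mul, hW1, one_mul] at hsum
  linarith

/-- If `I - ΞW` is singular, then some nonempty in-closed set has no stubborn agent. -/
lemma exists_inClosed_of_not_isUnit {n : ℕ} {W : Matrix (Fin n) (Fin n) ℝ} {ξ : Fin n → ℝ}
    (hW0 : ∀ i j, 0 ≤ W i j) (hW1 : ∀ i, ∑ j, W i j = 1) (hξ : ∀ i, 0 ≤ ξ i ∧ ξ i ≤ 1)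
    (hU : ¬ IsUnit (1 - Matrix.diagonal ξ * W)) :
    ∃ T : Set (Fin n), T.Nonempty ∧ (∀ i ∈ T, ∀ j, W i j ≠ 0 → j ∈ T) ∧ ∀ i ∈ T, 1 ≤ ξ i := by
  have hdet : (1 - Matrix.diagonal ξ * W).det = 0 := by
    by_contra hd
    exact hU ((Matrix.isUnit_iff_isUnit_det _).2 (Ne.isUnit hd))
  obtain ⟨x, hx0, hx⟩ := Matrix.exists_mulVec_eq_zero_iff.2 hdet
  obtain ⟨k, hk⟩ := Function.ne_iff.1 hx0
  obtain ⟨p, -, hp⟩ := Finset.exists_max_image Finset.univ (fun i => |x i|) ⟨k, mem_univ k⟩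
  replace hp : ∀ i, |x i| ≤ |x p| := fun i => hp i (mem_univ i)
  have hpos : 0 < |x p| := (abs_pos.2 hk).trans_le (hp k)
  have hle : ∀ i, ∑ j, W i j * |x j| ≤ |x p| := fun i =>
    calc ∑ j, W i j * |x j| ≤ ∑ j, W i j * |x p| :=
          Finset.sum_le_sum fun j _ => mul_le_mul_of_nonneg_left (hp j) (hW0 i j)
      _ = |x p| := by rw [← Finset.sum_mul, hW1, one_mul]
  have hfix : ∀ i, |x i| ≤ ξ i * ∑ j, W i j * |x j| := fun i => by
    have hxi := congrFun hx i
    rw [one_sub_diagonal_mul_mulVec_apply, Pi.zero_apply, sub_eq_zero] at hxi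
    calc |x i| = ξ i * |∑ j, W i j * x j| := by
          conv_lhs => rw [hxi]
          rw [abs_mul, abs_of_nonneg (hξ i).1]
      _ ≤ ξ i * ∑ j, W i j * |x j| := by
          refine mul_le_mul_of_nonneg_left ?_ (hξ i).1
          refine (Finset.abs_sum_le_sum_abs _ _).trans_eq (Finset.sum_congr rfl fun j _ => ?_)
          rw [abs_mul, abs_of_nonneg (hW0 i j)]
  refine ⟨{i | |x i| = |x p|}, ⟨p, rfl⟩, fun i hi j hj => ?_, fun i hi => ?_⟩
  · by_contra hne
    have hlt : ∑ l, W i l * |x l| < ∑ l, W i l * |x p| :=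
      Finset.sum_lt_sum (fun l _ => mul_le_mul_of_nonneg_left (hp l) (hW0 i l))
        ⟨j, mem_univ j, mul_lt_mul_of_pos_left ((hp j).lt_of_ne hne) ((hW0 i j).lt_of_ne' hj)⟩
    rw [← Finset.sum_mul, hW1, one_mul] at hlt
    have hnn : 0 ≤ ∑ l, W i l * |x l| :=
      Finset.sum_nonneg fun l _ => mul_nonneg (hW0 i l) (abs_nonneg _)
    have hi' : |x i| = |x p| := hi
    exact absurd ((hfix i).trans (mul_le_of_le_one_left hnn (hξ i).2)) (by linarith)
  · have hi' : |x i| = |x p| := hi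
    have h := (hfix i).trans (mul_le_mul_of_nonneg_left (hle i) (hξ i).1)
    rw [hi'] at h
    exact (le_mul_iff_one_le_left hpos).1 h

/-- Lemma 2: `I - ΞW` is invertible iff every ISCC of `G(W)` contains at least one
stubborn agent. -/
theorem one_sub_xiW_invertible_iff_assumption2
    (n : ℕ) (hn : 1 ≤ n)
    (W Ξ : Matrix (Fin n) (Fin n) ℝ) (ξ : Fin n → ℝ)
    (hW0 : ∀ i j, 0 ≤ W i j) (hW1 : ∀ i, ∑ j, W i j = 1)
    (hΞ : Ξ = Matrix.diagonal ξ) (hξ : ∀ i, 0 ≤ ξ i ∧ ξ i ≤ 1) :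
    IsUnit (1 - Ξ * W) ↔
      (∀ S : Set (Fin n), IsISCC W S → ∃ i ∈ S, ξ i < 1) := by
  subst hΞ
  refine ⟨fun hU S hS =>
    exists_lt_one_of_isUnit hW0 hW1 (fun i => (hξ i).2) hU hS.1 hS.2.1, fun h => ?_⟩
  by_contra hU
  obtain ⟨T, hne, hT, hT1⟩ := exists_inClosed_of_not_isUnit hW0 hW1 hξ hU
  obtain ⟨S, hST, hS⟩ := exists_isISCC_subset hW0 hW1 hne hT
  obtain ⟨i, hi, hlt⟩ := h S hS
  exact hlt.not_ge (hT1 i (hST hi))
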